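/- arXiv:1708.02847 — 3 statements merged into one kernel-verified Lean document; each statement's English description precedes it below -/
import Mathlib

section
/- Let g and h be 3-Lie algebras over a field K of characteristic 0, and equip g⊕h with the direct-sum 3-Lie bracket [x1+v1,x2+v2,x3+v3] = [x1,x2,x3]_g + [v1,v2,v3]_h, with structure map μ ∈ C¹(g⊕h,g⊕h) and δ̄α = ⟦μ,α⟧. Let C^k_>(g⊕h,h) ⊂ C^k(g⊕h,g⊕h) be the subspace of cochains taking values in h and vanishing whenever all of their arguments lie in h. Then: (a) for α ∈ C^p_>(g⊕h,h) and β ∈ C^q_>(g⊕h,h), ⟦α,β⟧ ∈ C^{p+q}_>(g⊕h,h); (b) δ̄α ∈ C^{p+1}_>(g⊕h,h); (c) the degree-0 part C⁰_>(g⊕h,h) = Hom(g,h) is abelian: ⟦ξ,η⟧ = 0 for all ξ,η ∈ Hom(g,h), where ξ,η are viewed as endomorphisms of g⊕h extended by 0 on h. -/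
/-- A `p`-cochain on `g`: a map taking `p` "wedge" arguments, each represented by a pair
`(xs i, ys i)` standing for `xs i ∧ ys i ∈ ⋀²g`, and one extra argument in `g`. -/
abbrev Cochain (g : Type*) (p : ℕ) : Type _ := (Fin p → g) → (Fin p → g) → g → g

/-- Membership in `C^p(g,g)`: multilinearity in all `2p+1` slots, antisymmetry in each
wedge pair (so that the map factors through `(⋀²g)^{⊗p} ⊗ g`), and being alternating in
the last three arguments. -/
def IsCochain (K : Type*) [Field K] {g : Type*} [AddCommGroup g] [Module K g]
    (p : ℕ) (f : Cochain g p) : Prop :=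
  (∀ (xs ys : Fin p → g) (z : g) (i : Fin p) (u v : g),
      f (Function.update xs i (u + v)) ys z
        = f (Function.update xs i u) ys z + f (Function.update xs i v) ys z) ∧
  (∀ (xs ys : Fin p → g) (z : g) (i : Fin p) (a : K) (u : g),
      f (Function.update xs i (a • u)) ys z = a • f (Function.update xs i u) ys z) ∧
  (∀ (xs ys : Fin p → g) (z : g) (i : Fin p) (u v : g),
      f xs (Function.update ys i (u + v)) z
        = f xs (Function.update ys i u) z + f xs (Function.update ys i v) z) ∧
  (∀ (xs ys : Fin p → g) (z : g) (i : Fin p) (a : K) (u : g),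
      f xs (Function.update ys i (a • u)) z = a • f xs (Function.update ys i u) z) ∧
  (∀ (xs ys : Fin p → g) (u v : g), f xs ys (u + v) = f xs ys u + f xs ys v) ∧
  (∀ (xs ys : Fin p → g) (a : K) (u : g), f xs ys (a • u) = a • f xs ys u) ∧
  (∀ (xs ys : Fin p → g) (z : g) (i : Fin p), xs i = ys i → f xs ys z = 0) ∧
  (∀ (xs ys : Fin p → g) (z : g) (i : Fin p), (i : ℕ) + 1 = p →
      (xs i = z ∨ ys i = z) → f xs ys z = 0)

open Classical in
/-- The `(k, m-k)`-unshuffles of the first `m` indices of `Fin n`, extended by the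
identity elsewhere. -/
noncomputable def unshuffles (n k m : ℕ) : Finset (Equiv.Perm (Fin n)) :=
  Finset.univ.filter fun σ =>
    (∀ i : Fin n, m ≤ (i : ℕ) → σ i = i) ∧
    (∀ i j : Fin n, (i : ℕ) < (j : ℕ) → (j : ℕ) < k → σ i < σ j) ∧
    (∀ i j : Fin n, k ≤ (i : ℕ) → (i : ℕ) < (j : ℕ) → (j : ℕ) < m → σ i < σ j)

/-- The circle product `α ∘ β` of cochains (Rothstein/Nijenhuis-Richardson-type product
for 3-Lie algebra cochains). -/
noncomputable def circProd {g : Type*} [AddCommGroup g] (p q : ℕ)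
    (α : Cochain g p) (β : Cochain g q) : Cochain g (p + q) :=
  fun xs ys z =>
    (∑ k : Fin p, ((-1 : ℤ) ^ ((k : ℕ) * q)) •
      ∑ σ ∈ unshuffles (p + q) (k : ℕ) ((k : ℕ) + q),
        (Equiv.Perm.sign σ : ℤ) •
          (α (fun i : Fin p =>
                if (i : ℕ) < (k : ℕ) then xs (σ (Fin.castLE (Nat.le_add_right p q) i))
                else if (i : ℕ) = (k : ℕ) then
                  β (fun j : Fin q => xs (σ ⟨(k : ℕ) + (j : ℕ),
                        by have := k.isLt; have := j.isLt; omega⟩))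
                    (fun j : Fin q => ys (σ ⟨(k : ℕ) + (j : ℕ),
                        by have := k.isLt; have := j.isLt; omega⟩))
                    (xs ⟨(k : ℕ) + q, by have := k.isLt; omega⟩)
                else xs ⟨(i : ℕ) + q, by have := i.isLt; omega⟩)
             (fun i : Fin p =>
                if (i : ℕ) < (k : ℕ) then ys (σ (Fin.castLE (Nat.le_add_right p q) i))
                else if (i : ℕ) = (k : ℕ) then ys ⟨(k : ℕ) + q, by have := k.isLt; omega⟩
                else ys ⟨(i : ℕ) + q, by have := i.isLt; omega⟩)
             z
           +
           α (fun i : Fin p =>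
                if (i : ℕ) < (k : ℕ) then xs (σ (Fin.castLE (Nat.le_add_right p q) i))
                else if (i : ℕ) = (k : ℕ) then xs ⟨(k : ℕ) + q, by have := k.isLt; omega⟩
                else xs ⟨(i : ℕ) + q, by have := i.isLt; omega⟩)
             (fun i : Fin p =>
                if (i : ℕ) < (k : ℕ) then ys (σ (Fin.castLE (Nat.le_add_right p q) i))
                else if (i : ℕ) = (k : ℕ) then
                  β (fun j : Fin q => xs (σ ⟨(k : ℕ) + (j : ℕ),
                        by have := k.isLt; have := j.isLt; omega⟩))
                    (fun j : Fin q => ys (σ ⟨(k : ℕ) + (j : ℕ),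
                        by have := k.isLt; have := j.isLt; omega⟩))
                    (ys ⟨(k : ℕ) + q, by have := k.isLt; omega⟩)
                else ys ⟨(i : ℕ) + q, by have := i.isLt; omega⟩)
             z))
    +
    ((-1 : ℤ) ^ (p * q)) •
      ∑ σ ∈ unshuffles (p + q) p (p + q),
        (Equiv.Perm.sign σ : ℤ) •
          α (fun i : Fin p => xs (σ (Fin.castLE (Nat.le_add_right p q) i)))
            (fun i : Fin p => ys (σ (Fin.castLE (Nat.le_add_right p q) i)))
            (β (fun j : Fin q => xs (σ ⟨p + (j : ℕ), by have := j.isLt; omega⟩))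
               (fun j : Fin q => ys (σ ⟨p + (j : ℕ), by have := j.isLt; omega⟩)) z)

/-- The graded commutator bracket `⟦α, β⟧ = α∘β - (-1)^{pq} β∘α` on cochains. -/
noncomputable def nrBracket {g : Type*} [AddCommGroup g] (p q : ℕ)
    (α : Cochain g p) (β : Cochain g q) : Cochain g (p + q) :=
  fun xs ys z =>
    circProd p q α β xs ys z
      - ((-1 : ℤ) ^ (p * q)) •
          circProd q p β α (fun i => xs (Fin.cast (Nat.add_comm q p) i))
            (fun i => ys (Fin.cast (Nat.add_comm q p) i)) z

/-- A cochain on `g ⊕ h` lies in `C^p_>(g⊕h, h)` when it takes values in `h` and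
vanishes whenever all of its arguments lie in `h`. -/
def IsRelCochain {g h : Type*} [AddCommGroup g] [AddCommGroup h]
    (p : ℕ) (f : Cochain (g × h) p) : Prop :=
  (∀ (xs ys : Fin p → g × h) (z : g × h), (f xs ys z).1 = 0) ∧
  (∀ (xs ys : Fin p → g × h) (z : g × h),
    (∀ i, (xs i).1 = 0) → (∀ i, (ys i).1 = 0) → z.1 = 0 → f xs ys z = 0)

/-- The direct-sum 3-Lie bracket on `g ⊕ h`, viewed as a degree-1 cochain. -/
def sumC1 {K : Type*} [Field K] {g h : Type*}
    [AddCommGroup g] [Module K g] [AddCommGroup h] [Module K h]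
    (bg : g →ₗ[K] g →ₗ[K] g →ₗ[K] g) (bh : h →ₗ[K] h →ₗ[K] h →ₗ[K] h) :
    Cochain (g × h) 1 :=
  fun xs ys z => (bg (xs 0).1 (ys 0).1 z.1, bh (xs 0).2 (ys 0).2 z.2)

/-- A linear map `ξ : g → h` viewed as a degree-0 cochain on `g ⊕ h`
(an endomorphism of `g ⊕ h`), extended by `0` on `h`. -/
def toC0 {K : Type*} [Field K] {g h : Type*}
    [AddCommGroup g] [Module K g] [AddCommGroup h] [Module K h]
    (ξ : g →ₗ[K] h) : Cochain (g × h) 0 :=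
  fun _ _ e => ((0 : g), ξ e.1)

/-- The part of `IsCochain` that does not involve the last three arguments jointly:
linearity in every slot and vanishing on pairs with equal entries. -/
structure IsPairAlternating (K : Type*) [Field K] {g : Type*} [AddCommGroup g] [Module K g]
    {p : ℕ} (f : Cochain g p) : Prop where
  linear_fst : ∀ xs ys z i, IsLinearMap K fun u => f (Function.update xs i u) ys z
  linear_snd : ∀ xs ys z i, IsLinearMap K fun u => f xs (Function.update ys i u) z
  linear_last : ∀ xs ys, IsLinearMap K fun u => f xs ys u
  eq_zero_of_eq : ∀ xs ys z i, xs i = ys i → f xs ys z = 0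

/-- Vanishing whenever the last argument equals an entry of the last pair. -/
def VanishesOnLast {g : Type*} [AddCommGroup g] {p : ℕ} (f : Cochain g p) : Prop :=
  ∀ (xs ys : Fin p → g) (z : g) (i : Fin p), (i : ℕ) + 1 = p →
    (xs i = z ∨ ys i = z) → f xs ys z = 0

section

variable {K : Type*} [Field K] {g : Type*} [AddCommGroup g] [Module K g]

theorem isCochain_iff {p : ℕ} {f : Cochain g p} :
    IsCochain K p f ↔ IsPairAlternating K f ∧ VanishesOnLast f := by
  constructor
  · rintro ⟨h1, h2, h3, h4, h5, h6, h7, h8⟩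
    exact ⟨⟨fun xs ys z i => ⟨h1 xs ys z i, h2 xs ys z i⟩,
      fun xs ys z i => ⟨h3 xs ys z i, h4 xs ys z i⟩,
      fun xs ys => ⟨h5 xs ys, h6 xs ys⟩, h7⟩, h8⟩
  · rintro ⟨⟨h1, h2, h3, h4⟩, h5⟩
    exact ⟨fun xs ys z i => (h1 xs ys z i).map_add, fun xs ys z i => (h1 xs ys z i).map_smul,
      fun xs ys z i => (h2 xs ys z i).map_add, fun xs ys z i => (h2 xs ys z i).map_smul,
      fun xs ys => (h3 xs ys).map_add, fun xs ys => (h3 xs ys).map_smul, h4, h5⟩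

theorem isLinearMap_comp {f f' : g → g} (hf : IsLinearMap K f) (hf' : IsLinearMap K f') :
    IsLinearMap K fun u => f (f' u) :=
  ⟨fun a b => by rw [hf'.map_add, hf.map_add], fun c a => by rw [hf'.map_smul, hf.map_smul]⟩

theorem isLinearMap_add {f f' : g → g} (hf : IsLinearMap K f) (hf' : IsLinearMap K f') :
    IsLinearMap K fun u => f u + f' u :=
  ⟨fun a b => by rw [hf'.map_add, hf.map_add]; abel,
    fun c a => by rw [hf'.map_smul, hf.map_smul, smul_add]⟩

theorem isLinearMap_zsmul (n : ℤ) {f : g → g} (hf : IsLinearMap K f) :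
    IsLinearMap K fun u => n • f u :=
  ⟨fun a b => by rw [hf.map_add, smul_add], fun c a => by rw [hf.map_smul, smul_comm]⟩

theorem isLinearMap_sum {ι : Type*} (s : Finset ι) {f : ι → g → g}
    (hf : ∀ i ∈ s, IsLinearMap K (f i)) : IsLinearMap K fun u => ∑ i ∈ s, f i u :=
  ⟨fun a b => by
      rw [← Finset.sum_add_distrib]
      exact Finset.sum_congr rfl fun i hi => (hf i hi).map_add a b,
    fun c a => by
      rw [Finset.smul_sum]
      exact Finset.sum_congr rfl fun i hi => (hf i hi).map_smul c a⟩

namespace IsPairAlternating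

theorem add {p : ℕ} {f f' : Cochain g p} (hf : IsPairAlternating K f)
    (hf' : IsPairAlternating K f') :
    IsPairAlternating K (fun xs ys z => f xs ys z + f' xs ys z : Cochain g p) where
  linear_fst xs ys z i := isLinearMap_add (hf.1 xs ys z i) (hf'.1 xs ys z i)
  linear_snd xs ys z i := isLinearMap_add (hf.2 xs ys z i) (hf'.2 xs ys z i)
  linear_last xs ys := isLinearMap_add (hf.3 xs ys) (hf'.3 xs ys)
  eq_zero_of_eq xs ys z i h := by rw [hf.4 xs ys z i h, hf'.4 xs ys z i h, add_zero]

theorem zsmul {p : ℕ} (n : ℤ) {f : Cochain g p} (hf : IsPairAlternating K f) :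
    IsPairAlternating K (fun xs ys z => n • f xs ys z : Cochain g p) where
  linear_fst xs ys z i := isLinearMap_zsmul n (hf.1 xs ys z i)
  linear_snd xs ys z i := isLinearMap_zsmul n (hf.2 xs ys z i)
  linear_last xs ys := isLinearMap_zsmul n (hf.3 xs ys)
  eq_zero_of_eq xs ys z i h := by rw [hf.4 xs ys z i h, smul_zero]

theorem sum {p : ℕ} {ι : Type*} (s : Finset ι) {f : ι → Cochain g p}
    (hf : ∀ j ∈ s, IsPairAlternating K (f j)) :
    IsPairAlternating K (fun xs ys z => ∑ j ∈ s, f j xs ys z : Cochain g p) where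
  linear_fst xs ys z i := isLinearMap_sum s fun j hj => (hf j hj).1 xs ys z i
  linear_snd xs ys z i := isLinearMap_sum s fun j hj => (hf j hj).2 xs ys z i
  linear_last xs ys := isLinearMap_sum s fun j hj => (hf j hj).3 xs ys
  eq_zero_of_eq xs ys z i h := Finset.sum_eq_zero fun j hj => (hf j hj).4 xs ys z i h

theorem comp_perm {p : ℕ} {f : Cochain g p} (hf : IsPairAlternating K f)
    (σ : Equiv.Perm (Fin p)) :
    IsPairAlternating K (fun xs ys z => f (xs ∘ σ) (ys ∘ σ) z : Cochain g p) where
  linear_fst xs ys z i := by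
    simpa only [Function.update_comp_equiv] using hf.1 (xs ∘ σ) (ys ∘ σ) z (σ.symm i)
  linear_snd xs ys z i := by
    simpa only [Function.update_comp_equiv] using hf.2 (xs ∘ σ) (ys ∘ σ) z (σ.symm i)
  linear_last xs ys := hf.3 _ _
  eq_zero_of_eq xs ys z i h := hf.4 _ _ z (σ.symm i) (by simpa using h)

theorem swap {p : ℕ} {f : Cochain g p} (hf : IsPairAlternating K f) :
    IsPairAlternating K (fun xs ys z => f ys xs z : Cochain g p) where
  linear_fst xs ys z i := hf.2 ys xs z i
  linear_snd xs ys z i := hf.1 ys xs z i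
  linear_last xs ys := hf.3 ys xs
  eq_zero_of_eq xs ys z i h := hf.4 ys xs z i h.symm

theorem update_add_update_eq_zero {p : ℕ} {f : Cochain g p} (hf : IsPairAlternating K f)
    (xs ys : Fin p → g) (z : g) (i : Fin p) (u v : g) :
    f (Function.update xs i u) (Function.update ys i v) z
      + f (Function.update xs i v) (Function.update ys i u) z = 0 := by
  have h : ∀ w, f (Function.update xs i w) (Function.update ys i w) z = 0 := fun w =>
    hf.4 _ _ z i (by simp)
  have key := h (u + v)
  rw [(hf.1 xs _ z i).map_add, (hf.2 _ ys z i).map_add, (hf.2 _ ys z i).map_add, h, h] at key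
  simpa using key

end IsPairAlternating

/-- The entries `xs k, …, xs (k + q - 1)`. -/
def blockArg {p : ℕ} (q k : ℕ) (hk : k ≤ p) (xs : Fin (p + q) → g) : Fin q → g :=
  fun j => xs ⟨k + j, by have := j.isLt; omega⟩

/-- The tuple obtained from `xs` by replacing the entries `k, …, k + q` by the single entry `w`. -/
def insertArg {p : ℕ} (q : ℕ) (k : Fin p) (w : g) (xs : Fin (p + q) → g) : Fin p → g :=
  fun i => if (i : ℕ) < (k : ℕ) then xs (Fin.castLE (Nat.le_add_right p q) i)
    else if (i : ℕ) = (k : ℕ) then w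
    else xs ⟨(i : ℕ) + q, by have := i.isLt; omega⟩

/-- The entry of index `k + q`. -/
def pivotArg {p : ℕ} (q : ℕ) (k : Fin p) (xs : Fin (p + q) → g) : g :=
  xs ⟨(k : ℕ) + q, by have := k.isLt; omega⟩

/-- The cochain `α(X₁, …, β(X_{k+1}, …, X_{k+q}, x_{k+q+1}) ∧ y_{k+q+1}, …, z)`. -/
def insertFst {p q : ℕ} (α : Cochain g p) (β : Cochain g q) (k : Fin p) : Cochain g (p + q) :=
  fun xs ys z => α
    (insertArg q k (β (blockArg q k k.isLt.le xs) (blockArg q k k.isLt.le ys) (pivotArg q k xs)) xs)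
    (insertArg q k (pivotArg q k ys) ys) z

/-- The cochain `α(X₁, …, x_{k+q+1} ∧ β(X_{k+1}, …, X_{k+q}, y_{k+q+1}), …, z)`. -/
def insertSnd {p q : ℕ} (α : Cochain g p) (β : Cochain g q) (k : Fin p) : Cochain g (p + q) :=
  fun xs ys z => α (insertArg q k (pivotArg q k xs) xs)
    (insertArg q k (β (blockArg q k k.isLt.le xs) (blockArg q k k.isLt.le ys) (pivotArg q k ys)) ys)
    z

/-- The cochain `α(X₁, …, X_p, β(X_{p+1}, …, X_{p+q}, z))`. -/
def insertLast {p q : ℕ} (α : Cochain g p) (β : Cochain g q) : Cochain g (p + q) :=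
  fun xs ys z => α (fun i => xs (Fin.castLE (Nat.le_add_right p q) i))
    (fun i => ys (Fin.castLE (Nat.le_add_right p q) i))
    (β (blockArg q p le_rfl xs) (blockArg q p le_rfl ys) z)

theorem circProd_eq (p q : ℕ) (α : Cochain g p) (β : Cochain g q) (xs ys : Fin (p + q) → g)
    (z : g) :
    circProd p q α β xs ys z =
      (∑ k : Fin p, ((-1 : ℤ) ^ ((k : ℕ) * q)) •
        ∑ σ ∈ unshuffles (p + q) (k : ℕ) ((k : ℕ) + q), (Equiv.Perm.sign σ : ℤ) •
          (insertFst α β k (xs ∘ σ) (ys ∘ σ) z + insertSnd α β k (xs ∘ σ) (ys ∘ σ) z)) +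
      ((-1 : ℤ) ^ (p * q)) •
        ∑ σ ∈ unshuffles (p + q) p (p + q), (Equiv.Perm.sign σ : ℤ) •
          insertLast α β (xs ∘ σ) (ys ∘ σ) z := by
  unfold circProd
  congr 1
  refine Finset.sum_congr rfl fun k _ => ?_
  congr 1
  refine Finset.sum_congr rfl fun σ hσ => ?_
  have hfix : ∀ i : Fin (p + q), (k : ℕ) + q ≤ i → σ i = i := by
    simp only [unshuffles, Finset.mem_filter] at hσ
    exact hσ.2.1
  have hpivot : ∀ ws : Fin (p + q) → g, pivotArg q k (ws ∘ σ) = pivotArg q k ws := fun ws => by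
    simp [pivotArg, hfix]
  have hinsert : ∀ (w : g) (ws : Fin (p + q) → g), insertArg q k w (ws ∘ σ) = fun i : Fin p =>
      if (i : ℕ) < (k : ℕ) then ws (σ (Fin.castLE (Nat.le_add_right p q) i))
      else if (i : ℕ) = (k : ℕ) then w
      else ws ⟨(i : ℕ) + q, by have := i.isLt; omega⟩ := fun w ws => by
    funext i
    unfold insertArg
    split_ifs with h1 h2
    · rfl
    · rfl
    · rw [Function.comp_apply, hfix _ (by simp; omega)]
  simp only [insertFst, insertSnd, hpivot, hinsert]
  rfl

end

section

variable {g : Type*} {p q : ℕ}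

theorem update_insertArg (k : Fin p) (v w : g) (xs : Fin (p + q) → g) :
    Function.update (insertArg q k v xs) k w = insertArg q k w xs := by
  funext i
  simp only [insertArg, Function.update_apply, Fin.ext_iff]
  split_ifs <;> first | rfl | omega

theorem insertArg_update_of_lt (k : Fin p) (w : g) (xs : Fin (p + q) → g) (m : Fin (p + q))
    (u : g) (h : (m : ℕ) < k) :
    insertArg q k w (Function.update xs m u)
      = Function.update (insertArg q k w xs) ⟨m, h.trans k.isLt⟩ u := by
  funext i
  simp only [insertArg, Function.update_apply, Fin.ext_iff, Fin.val_castLE]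
  split_ifs <;> first | rfl | omega

theorem insertArg_update_of_gt (k : Fin p) (w : g) (xs : Fin (p + q) → g) (m : Fin (p + q))
    (u : g) (h : (k : ℕ) + q < m) :
    insertArg q k w (Function.update xs m u)
      = Function.update (insertArg q k w xs) ⟨m - q, by omega⟩ u := by
  funext i
  simp only [insertArg, Function.update_apply, Fin.ext_iff, Fin.val_castLE]
  split_ifs <;> first | rfl | omega

theorem insertArg_update_of_mem (k : Fin p) (w : g) (xs : Fin (p + q) → g) (m : Fin (p + q))
    (u : g) (h : (k : ℕ) ≤ m) (h' : (m : ℕ) ≤ k + q) :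
    insertArg q k w (Function.update xs m u) = insertArg q k w xs := by
  funext i
  simp only [insertArg, Function.update_apply, Fin.ext_iff, Fin.val_castLE]
  split_ifs <;> first | rfl | omega

theorem blockArg_update_of_mem (k : ℕ) (hk : k ≤ p) (xs : Fin (p + q) → g) (m : Fin (p + q))
    (u : g) (h : k ≤ m) (h' : (m : ℕ) < k + q) :
    blockArg q k hk (Function.update xs m u)
      = Function.update (blockArg q k hk xs) ⟨m - k, by omega⟩ u := by
  funext i
  simp only [blockArg, Function.update_apply, Fin.ext_iff]
  split_ifs <;> first | rfl | omega

theorem blockArg_update_of_notMem (k : ℕ) (hk : k ≤ p) (xs : Fin (p + q) → g) (m : Fin (p + q))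
    (u : g) (h : (m : ℕ) < k ∨ k + q ≤ m) :
    blockArg q k hk (Function.update xs m u) = blockArg q k hk xs := by
  funext i
  simp only [blockArg, Function.update_apply, Fin.ext_iff]
  split_ifs <;> first | rfl | omega

theorem pivotArg_update_of_ne (k : Fin p) (xs : Fin (p + q) → g) (m : Fin (p + q))
    (u : g) (h : (m : ℕ) ≠ k + q) :
    pivotArg q k (Function.update xs m u) = pivotArg q k xs := by
  simp only [pivotArg, Function.update_apply, Fin.ext_iff]
  split_ifs <;> first | rfl | omega

theorem pivotArg_update_of_eq (k : Fin p) (xs : Fin (p + q) → g) (m : Fin (p + q))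
    (u : g) (h : (m : ℕ) = k + q) :
    pivotArg q k (Function.update xs m u) = u := by
  simp only [pivotArg, Function.update_apply, Fin.ext_iff]
  split_ifs <;> first | rfl | omega

theorem insertArg_one_zero (w : g) (xs : Fin (1 + q) → g) (k : Fin 1) :
    insertArg q k w xs 0 = w := by
  simp [insertArg, Subsingleton.elim k 0]

theorem insertArg_fst_eq_zero {h : Type*} [Zero g] {k : Fin p} {w : g × h}
    {xs : Fin (p + q) → g × h} (hw : w.1 = 0) (hxs : ∀ i, (xs i).1 = 0) (i : Fin p) :
    (insertArg q k w xs i).1 = 0 := by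
  unfold insertArg
  split_ifs
  exacts [hxs _, hw, hxs _]

end

section

variable {K : Type*} [Field K] {g : Type*} [AddCommGroup g] [Module K g] {p q : ℕ}
  {α : Cochain g p} {β : Cochain g q}

namespace IsPairAlternating

theorem isLinearMap_insertArg_fst (hα : IsPairAlternating K α) (k : Fin p)
    (xs : Fin (p + q) → g) (ys : Fin p → g) (z : g) :
    IsLinearMap K fun w => α (insertArg q k w xs) ys z := by
  simpa only [update_insertArg] using hα.1 (insertArg q k 0 xs) ys z k

theorem isLinearMap_insertArg_snd (hα : IsPairAlternating K α) (k : Fin p)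
    (xs : Fin p → g) (ys : Fin (p + q) → g) (z : g) :
    IsLinearMap K fun w => α xs (insertArg q k w ys) z := by
  simpa only [update_insertArg] using hα.2 xs (insertArg q k 0 ys) z k

theorem isLinearMap_insertFst_fst (hα : IsPairAlternating K α) (hβ : IsPairAlternating K β)
    (k : Fin p) (xs ys : Fin (p + q) → g) (z : g) (m : Fin (p + q)) :
    IsLinearMap K fun u => insertFst α β k (Function.update xs m u) ys z := by
  unfold insertFst
  rcases lt_or_ge (m : ℕ) k with h | h
  · simp only [blockArg_update_of_notMem _ _ _ _ _ (Or.inl h),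
      pivotArg_update_of_ne k xs m _ (by omega), insertArg_update_of_lt k _ xs m _ h]
    exact hα.1 _ _ _ _
  rcases lt_trichotomy (m : ℕ) (k + q) with h' | h' | h'
  · simp only [blockArg_update_of_mem _ _ _ _ _ h h', pivotArg_update_of_ne k xs m _ h'.ne,
      insertArg_update_of_mem k _ xs m _ h h'.le]
    exact isLinearMap_comp (hα.isLinearMap_insertArg_fst k xs _ z) (hβ.1 _ _ _ _)
  · simp only [blockArg_update_of_notMem _ _ _ _ _ (Or.inr h'.ge),
      pivotArg_update_of_eq k xs m _ h', insertArg_update_of_mem k _ xs m _ h h'.le]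
    exact isLinearMap_comp (hα.isLinearMap_insertArg_fst k xs _ z) (hβ.3 _ _)
  · simp only [blockArg_update_of_notMem _ _ _ _ _ (Or.inr h'.le),
      pivotArg_update_of_ne k xs m _ h'.ne', insertArg_update_of_gt k _ xs m _ h']
    exact hα.1 _ _ _ _

theorem isLinearMap_insertFst_snd (hα : IsPairAlternating K α) (hβ : IsPairAlternating K β)
    (k : Fin p) (xs ys : Fin (p + q) → g) (z : g) (m : Fin (p + q)) :
    IsLinearMap K fun u => insertFst α β k xs (Function.update ys m u) z := by
  unfold insertFst
  rcases lt_or_ge (m : ℕ) k with h | h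
  · simp only [blockArg_update_of_notMem _ _ _ _ _ (Or.inl h),
      pivotArg_update_of_ne k ys m _ (by omega), insertArg_update_of_lt k _ ys m _ h]
    exact hα.2 _ _ _ _
  rcases lt_trichotomy (m : ℕ) (k + q) with h' | h' | h'
  · simp only [blockArg_update_of_mem _ _ _ _ _ h h', pivotArg_update_of_ne k ys m _ h'.ne,
      insertArg_update_of_mem k _ ys m _ h h'.le]
    exact isLinearMap_comp (hα.isLinearMap_insertArg_fst k xs _ z) (hβ.2 _ _ _ _)
  · simp only [blockArg_update_of_notMem _ _ _ _ _ (Or.inr h'.ge),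
      pivotArg_update_of_eq k ys m _ h', insertArg_update_of_mem k _ ys m _ h h'.le]
    exact hα.isLinearMap_insertArg_snd k _ ys z
  · simp only [blockArg_update_of_notMem _ _ _ _ _ (Or.inr h'.le),
      pivotArg_update_of_ne k ys m _ h'.ne', insertArg_update_of_gt k _ ys m _ h']
    exact hα.2 _ _ _ _

theorem insertFst_add_insertSnd (hα : IsPairAlternating K α) (hβ : IsPairAlternating K β)
    (k : Fin p) :
    IsPairAlternating K
      (fun xs ys z => insertFst α β k xs ys z + insertSnd α β k xs ys z :
        Cochain g (p + q)) where
  linear_fst xs ys z m := isLinearMap_add (hα.isLinearMap_insertFst_fst hβ k xs ys z m)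
    (hα.swap.isLinearMap_insertFst_snd hβ.swap k ys xs z m)
  linear_snd xs ys z m := isLinearMap_add (hα.isLinearMap_insertFst_snd hβ k xs ys z m)
    (hα.swap.isLinearMap_insertFst_fst hβ.swap k ys xs z m)
  linear_last xs ys := isLinearMap_add (hα.3 _ _) (hα.3 _ _)
  eq_zero_of_eq xs ys z m h := by
    have hlt : ∀ v w, (m : ℕ) < k → α (insertArg q k v xs) (insertArg q k w ys) z = 0 :=
      fun v w hm => hα.4 _ _ _ ⟨m, hm.trans k.isLt⟩ (by simpa [insertArg, hm] using h)
    have hgt : ∀ v w, (k : ℕ) + q < m → α (insertArg q k v xs) (insertArg q k w ys) z = 0 := by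
      intro v w hm
      refine hα.4 _ _ _ ⟨m - q, by omega⟩ ?_
      have h1 : ¬ (m : ℕ) - q < k := by omega
      have h2 : ¬ (m : ℕ) - q = k := by omega
      have h3 : (m : ℕ) - q + q = m := by omega
      simpa [insertArg, h1, h2, h3] using h
    have hmem : ∀ w, (k : ℕ) ≤ m → (m : ℕ) < k + q →
        β (blockArg q k k.isLt.le xs) (blockArg q k k.isLt.le ys) w = 0 := by
      intro w hm hm'
      refine hβ.4 _ _ _ ⟨m - k, by omega⟩ ?_
      have h1 : (k : ℕ) + (m - k) = m := by omega
      simpa [blockArg, h1] using h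
    unfold insertFst insertSnd
    rcases lt_or_ge (m : ℕ) k with hm | hm
    · rw [hlt _ _ hm, hlt _ _ hm, add_zero]
    rcases lt_trichotomy (m : ℕ) (k + q) with hm' | hm' | hm'
    · rw [hmem _ hm hm', hmem _ hm hm', (hα.isLinearMap_insertArg_fst k xs _ z).map_zero,
        (hα.isLinearMap_insertArg_snd k _ ys z).map_zero, add_zero]
    · have hpivot : pivotArg q k ys = pivotArg q k xs := by
        have : m = ⟨(k : ℕ) + q, by omega⟩ := Fin.ext hm'
        rw [pivotArg, pivotArg, ← this, h]
      rw [hpivot]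
      simpa only [update_insertArg] using
        hα.update_add_update_eq_zero (insertArg q k 0 xs) (insertArg q k 0 ys) z k _ _
    · rw [hgt _ _ hm', hgt _ _ hm', add_zero]

theorem isLinearMap_insertLast_fst (hα : IsPairAlternating K α) (hβ : IsPairAlternating K β)
    (xs ys : Fin (p + q) → g) (z : g) (m : Fin (p + q)) :
    IsLinearMap K fun u => insertLast α β (Function.update xs m u) ys z := by
  unfold insertLast
  rcases lt_or_ge (m : ℕ) p with h | h
  · have : ∀ u, (fun i => Function.update xs m u (Fin.castLE (Nat.le_add_right p q) i))
        = Function.update (fun i => xs (Fin.castLE (Nat.le_add_right p q) i)) ⟨m, h⟩ u :=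
      fun u => by
        funext i
        simp [Function.update_apply, Fin.ext_iff]
    simp only [blockArg_update_of_notMem _ _ _ _ _ (Or.inl h), this]
    exact hα.1 _ _ _ _
  · have : ∀ u, (fun i => Function.update xs m u (Fin.castLE (Nat.le_add_right p q) i))
        = fun i => xs (Fin.castLE (Nat.le_add_right p q) i) := fun u => by
      funext i
      rw [Function.update_of_ne]
      simp only [ne_eq, Fin.ext_iff, Fin.val_castLE]
      omega
    simp only [blockArg_update_of_mem _ _ _ _ _ h m.isLt, this]
    exact isLinearMap_comp (hα.3 _ _) (hβ.1 _ _ _ _)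

theorem insertLast (hα : IsPairAlternating K α) (hβ : IsPairAlternating K β) :
    IsPairAlternating K (insertLast α β) where
  linear_fst xs ys z m := hα.isLinearMap_insertLast_fst hβ xs ys z m
  linear_snd xs ys z m := hα.swap.isLinearMap_insertLast_fst hβ.swap ys xs z m
  linear_last xs ys := by
    unfold _root_.insertLast
    exact isLinearMap_comp (hα.3 _ _) (hβ.3 _ _)
  eq_zero_of_eq xs ys z m h := by
    unfold _root_.insertLast
    rcases lt_or_ge (m : ℕ) p with hm | hm
    · exact hα.4 _ _ _ ⟨m, hm⟩ h
    · rw [hβ.4 _ _ _ ⟨m - p, by omega⟩, (hα.3 _ _).map_zero]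
      have h1 : p + ((m : ℕ) - p) = m := by omega
      simpa [blockArg, h1] using h

theorem circProd (hα : IsPairAlternating K α) (hβ : IsPairAlternating K β) :
    IsPairAlternating K (circProd p q α β) := by
  have h : _root_.circProd p q α β = _ :=
    funext fun xs => funext fun ys => funext fun z => circProd_eq p q α β xs ys z
  rw [h]
  exact (sum _ fun k _ => (sum _ fun σ _ =>
    ((hα.insertFst_add_insertSnd hβ k).comp_perm σ).zsmul _).zsmul _).add
    ((sum _ fun σ _ => ((hα.insertLast hβ).comp_perm σ).zsmul _).zsmul _)

end IsPairAlternating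
end

section

variable {n : ℕ}

theorem mem_unshuffles {k m : ℕ} {σ : Equiv.Perm (Fin n)} :
    σ ∈ unshuffles n k m ↔
      (∀ i : Fin n, m ≤ (i : ℕ) → σ i = i) ∧
      (∀ i j : Fin n, (i : ℕ) < (j : ℕ) → (j : ℕ) < k → σ i < σ j) ∧
      (∀ i j : Fin n, k ≤ (i : ℕ) → (i : ℕ) < (j : ℕ) → (j : ℕ) < m → σ i < σ j) := by
  simp [unshuffles]

/-- In an unshuffle of all of `Fin n`, the maximal index sits at the end of one of the two
blocks. -/
theorem eq_or_eq_of_mem_unshuffles {k : ℕ} (hk : k ≤ n) {σ : Equiv.Perm (Fin n)}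
    (hσ : σ ∈ unshuffles n k n) {t M : Fin n} (hM : (M : ℕ) + 1 = n) (ht : σ t = M) :
    (t : ℕ) + 1 = k ∨ (k ≤ (t : ℕ) ∧ t = M) := by
  obtain ⟨-, h1, h2⟩ := mem_unshuffles.1 hσ
  have hle : ∀ j, ¬ σ t < σ j := fun j hj => by
    have := (σ j).isLt
    rw [ht, Fin.lt_def] at hj
    omega
  by_contra! hcon
  rcases lt_or_ge (t : ℕ) k with h | h
  · by_cases hn : (t : ℕ) + 1 < n
    · exact hle ⟨t + 1, hn⟩ (h1 _ _ (Nat.lt_succ_self _) (lt_of_le_of_ne h hcon.1))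
    · omega
  · have hne := hcon.2 h
    rw [ne_eq, Fin.ext_iff] at hne
    have hn : (t : ℕ) + 1 < n := by omega
    exact hle ⟨t + 1, hn⟩ (h2 _ _ h (Nat.lt_succ_self _) hn)

theorem val_cycleIcc [NeZero n] {R M : Fin n} (hRM : R ≤ M) (i : Fin n) (hi : i ≤ M) :
    (Fin.cycleIcc R M i : ℕ) = if i < R then (i : ℕ) else if i = M then (R : ℕ) else i + 1 := by
  split_ifs with h1 h2
  · rw [Fin.cycleIcc_of_lt h1]
  · rw [h2, Fin.cycleIcc_of_last hRM]
  · have hlt := lt_of_le_of_ne hi h2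
    rw [Fin.cycleIcc_of_ge_of_lt (not_lt.1 h1) hlt]
    exact Fin.val_add_one_of_lt' (by omega)

theorem mul_cycleIcc_mem_unshuffles_iff [NeZero n] {R M : Fin n} (hRM : R ≤ M)
    (hM : (M : ℕ) + 1 = n) (σ : Equiv.Perm (Fin n)) :
    σ * Fin.cycleIcc R M ∈ unshuffles n R M ↔ σ ∈ unshuffles n (R + 1) n ∧ σ R = M := by
  have hlt : ∀ i, i < R → Fin.cycleIcc R M i = i := fun i hi => Fin.cycleIcc_of_lt hi
  have hlast : Fin.cycleIcc R M M = R := Fin.cycleIcc_of_last hRM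
  have hmid : ∀ i j : Fin n, (R : ℕ) ≤ i → (j : ℕ) = i + 1 → Fin.cycleIcc R M i = j := by
    intro i j hi hj
    have hjn := j.isLt
    apply Fin.ext
    rw [val_cycleIcc hRM i (by rw [Fin.le_def]; omega), if_neg (by rw [Fin.lt_def]; omega),
      if_neg (by rw [Fin.ext_iff]; omega), hj]
  have hleM : ∀ i : Fin n, (i : ℕ) ≤ M := fun i => by omega
  simp only [mem_unshuffles, Equiv.Perm.mul_apply]
  constructor
  · rintro ⟨h0, h1, h2⟩
    have hR : σ R = M := by simpa [hlast] using h0 M le_rfl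
    refine ⟨⟨fun i hi => absurd i.isLt (by omega), fun i j hij hj => ?_, fun i j hi hij _ => ?_⟩, hR⟩
    · rcases Nat.lt_succ_iff_lt_or_eq.1 hj with hj' | hj'
      · simpa [hlt _ hj', hlt i (hij.trans hj')] using h1 i j hij hj'
      · obtain rfl : j = R := Fin.ext hj'
        rw [hR]
        refine lt_of_le_of_ne (hleM _) fun h => ?_
        rw [← hR] at h
        exact hij.ne (congrArg Fin.val (σ.injective h))
    · have := h2 ⟨i - 1, by omega⟩ ⟨j - 1, by omega⟩ (by simp only; omega) (by simp only; omega)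
        (by have := hleM j; simp only; omega)
      rwa [hmid _ i (by simp only; omega) (by simp only; omega),
        hmid _ j (by simp only; omega) (by simp only; omega)] at this
  · rintro ⟨⟨-, h1, h2⟩, hR⟩
    refine ⟨fun i hi => ?_, fun i j hij hj => ?_, fun i j hi hij hj => ?_⟩
    · obtain rfl : i = M := Fin.ext (le_antisymm (hleM i) hi)
      rw [hlast, hR]
    · rw [hlt _ hj, hlt i (hij.trans hj)]
      exact h1 i j hij (hj.trans (Nat.lt_succ_self _))
    · rw [hmid i ⟨i + 1, by omega⟩ hi rfl, hmid j ⟨j + 1, by omega⟩ (by omega) rfl]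
      exact h2 _ _ (by simp only; omega) (by simp only; omega) (by simp only; omega)

end

section

variable {K : Type*} [Field K] {g : Type*} [AddCommGroup g] [Module K g] {p q : ℕ}
  {α : Cochain g p} {β : Cochain g q}

theorem VanishesOnLast.swap (h : VanishesOnLast α) :
    VanishesOnLast (fun xs ys z => α ys xs z : Cochain g p) :=
  fun xs ys z i hi hz => h ys xs z i hi hz.symm

theorem VanishesOnLast.update_add_eq_zero (hα : IsPairAlternating K α) (h : VanishesOnLast α)
    (xs ys : Fin p → g) {i : Fin p} (hi : (i : ℕ) + 1 = p) (u v : g) :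
    α (Function.update xs i u) ys v + α (Function.update xs i v) ys u = 0 := by
  have hz : ∀ w, α (Function.update xs i w) ys w = 0 := fun w =>
    h _ _ _ i hi (Or.inl (by simp))
  have key := hz (u + v)
  rw [(hα.1 xs ys _ i).map_add, (hα.3 _ ys).map_add, (hα.3 _ ys).map_add, hz, hz] at key
  simpa using key

/-- Acting on the last three arguments of `α` by a derivation preserves alternation. -/
theorem VanishesOnLast.derivation_eq_zero (hα : IsPairAlternating K α) (h : VanishesOnLast α)
    (xs ys : Fin p → g) {i : Fin p} (hi : (i : ℕ) + 1 = p) (b : g → g) {x y z : g}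
    (hz : x = z ∨ y = z) :
    α (Function.update xs i (b x)) (Function.update ys i y) z
      + α (Function.update xs i x) (Function.update ys i (b y)) z
      + α (Function.update xs i x) (Function.update ys i y) (b z) = 0 := by
  rcases hz with rfl | rfl
  · rw [h (Function.update xs i x) _ x i hi (Or.inl (by simp)), add_zero]
    exact h.update_add_eq_zero hα xs _ hi _ _
  · rw [h _ (Function.update ys i y) y i hi (Or.inr (by simp)), zero_add]
    exact h.swap.update_add_eq_zero hα.swap ys _ hi _ _

theorem insertFst_eq_zero (h : VanishesOnLast α) {k : Fin p} (hk : (k : ℕ) + 1 < p)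
    {xs ys : Fin (p + q) → g} {z : g} {m : Fin (p + q)} (hm : (m : ℕ) + 1 = p + q)
    (hz : xs m = z ∨ ys m = z) : insertFst α β k xs ys z = 0 := by
  refine h _ _ _ ⟨p - 1, by omega⟩ (by simp only; omega) ?_
  have h1 : ¬ p - 1 < (k : ℕ) := by omega
  have h2 : ¬ p - 1 = (k : ℕ) := by omega
  have h3 : (⟨p - 1 + q, by omega⟩ : Fin (p + q)) = m := Fin.ext (by simp only; omega)
  simpa [insertArg, h1, h2, h3] using hz

theorem insertSnd_eq_zero (h : VanishesOnLast α) {k : Fin p} (hk : (k : ℕ) + 1 < p)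
    {xs ys : Fin (p + q) → g} {z : g} {m : Fin (p + q)} (hm : (m : ℕ) + 1 = p + q)
    (hz : xs m = z ∨ ys m = z) : insertSnd α β k xs ys z = 0 :=
  insertFst_eq_zero (β := fun xs ys z => β ys xs z) h.swap hk hm hz.symm

theorem insertLast_eq_zero (hα : IsPairAlternating K α) (h : VanishesOnLast β)
    {xs ys : Fin (p + q) → g} {z : g} {m : Fin (p + q)} (hm : (m : ℕ) + 1 = p + q)
    (hpm : p ≤ m) (hz : xs m = z ∨ ys m = z) : insertLast α β xs ys z = 0 := by
  rw [insertLast, h _ _ _ ⟨m - p, by omega⟩ (by simp only; omega), (hα.3 _ _).map_zero]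
  have h1 : p + ((m : ℕ) - p) = m := by omega
  simpa [blockArg, h1] using hz

end

section

variable {K : Type*} [Field K] {g : Type*} [AddCommGroup g] [Module K g] {r q : ℕ}
  {α : Cochain g (r + 1)} {β : Cochain g q}

theorem insert_last_add_insertLast_eq_zero (hα : IsPairAlternating K α) (h : VanishesOnLast α)
    {R M : Fin (r + 1 + q)} (hR : (R : ℕ) = r) (hM : (M : ℕ) = r + q)
    {xs ys : Fin (r + 1 + q) → g} {z : g} (hz : xs M = z ∨ ys M = z) :
    insertFst α β (Fin.last r) xs ys z + insertSnd α β (Fin.last r) xs ys z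
      + insertLast α β (xs ∘ (Fin.cycleIcc R M).symm) (ys ∘ (Fin.cycleIcc R M).symm) z = 0 := by
  have : NeZero (r + 1 + q) := ⟨by omega⟩
  have hRM : R ≤ M := by rw [Fin.le_def]; omega
  have hpivot : ∀ ws : Fin (r + 1 + q) → g, pivotArg q (Fin.last r) ws = ws M := fun ws => by
    rw [pivotArg]
    exact congrArg ws (Fin.ext hM.symm)
  have hhead : ∀ ws : Fin (r + 1 + q) → g,
      (fun i => (ws ∘ (Fin.cycleIcc R M).symm) (Fin.castLE (Nat.le_add_right (r + 1) q) i))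
        = insertArg q (Fin.last r) (ws M) ws := fun ws => by
    funext i
    rw [Function.comp_apply, insertArg, Fin.val_last]
    split_ifs with h1 h2
    · congr 1
      rw [Equiv.symm_apply_eq, Fin.cycleIcc_of_lt]
      rw [Fin.lt_def, hR]
      exact h1
    · congr 1
      rw [Equiv.symm_apply_eq, Fin.cycleIcc_of_last hRM]
      exact Fin.ext (h2.trans hR.symm)
    · omega
  have hblock : ∀ ws : Fin (r + 1 + q) → g,
      blockArg q (r + 1) le_rfl (ws ∘ (Fin.cycleIcc R M).symm)
        = blockArg q r (Nat.le_succ r) ws := fun ws => by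
    funext j
    have hj := j.isLt
    rw [blockArg, blockArg, Function.comp_apply]
    congr 1
    rw [Equiv.symm_apply_eq]
    apply Fin.ext
    rw [val_cycleIcc hRM _ (by rw [Fin.le_def]; simp only; omega),
      if_neg (by rw [Fin.lt_def]; simp only; omega),
      if_neg (by rw [Fin.ext_iff]; simp only; omega)]
    simp only
    omega
  have key := h.derivation_eq_zero hα (insertArg q (Fin.last r) 0 xs)
    (insertArg q (Fin.last r) 0 ys) (i := Fin.last r) (by simp)
    (β (blockArg q r (Nat.le_succ r) xs) (blockArg q r (Nat.le_succ r) ys)) hz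
  simp only [update_insertArg] at key
  rw [insertFst, insertSnd, insertLast, hhead, hhead, hblock, hblock, hpivot, hpivot]
  exact key

theorem sum_insertLast_eq (hα : IsPairAlternating K α) (h : VanishesOnLast β)
    {R M : Fin (r + 1 + q)} (hR : (R : ℕ) = r) (hM : (M : ℕ) = r + q)
    {xs ys : Fin (r + 1 + q) → g} {z : g} (hz : xs M = z ∨ ys M = z) :
    ∑ σ ∈ unshuffles (r + 1 + q) (r + 1) (r + 1 + q), (Equiv.Perm.sign σ : ℤ) •
        insertLast α β (xs ∘ σ) (ys ∘ σ) z
      = (-1 : ℤ) ^ q • ∑ τ ∈ unshuffles (r + 1 + q) r (r + q), (Equiv.Perm.sign τ : ℤ) •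
        insertLast α β ((xs ∘ τ) ∘ (Fin.cycleIcc R M).symm)
          ((ys ∘ τ) ∘ (Fin.cycleIcc R M).symm) z := by
  classical
  have : NeZero (r + 1 + q) := ⟨by omega⟩
  have hRM : R ≤ M := by rw [Fin.le_def]; omega
  have hM' : (M : ℕ) + 1 = r + 1 + q := by omega
  rw [← Finset.sum_subset (Finset.filter_subset (fun σ => σ R = M) _), Finset.smul_sum]
  · refine Finset.sum_equiv (Equiv.mulRight (Fin.cycleIcc R M)) (fun σ => ?_) fun σ _ => ?_
    · have := mul_cycleIcc_mem_unshuffles_iff hRM hM' σ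
      rw [hR, hM] at this
      rw [Finset.mem_filter, Equiv.coe_mulRight, this]
    · have hsign : (Equiv.Perm.sign (Fin.cycleIcc R M) : ℤ) = (-1) ^ q := by
        rw [Fin.sign_cycleIcc_of_le hRM, show (M : ℕ) - R = q by omega]
        simp
      have hcomp : ∀ ws : Fin (r + 1 + q) → g,
          (ws ∘ (σ * Fin.cycleIcc R M : Equiv.Perm _)) ∘ (Fin.cycleIcc R M).symm = ws ∘ σ :=
        fun ws => by
          funext i
          simp
      rw [Equiv.coe_mulRight, hcomp, hcomp, Equiv.Perm.sign_mul, Units.val_mul, hsign, smul_smul]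
      congr 1
      rw [mul_left_comm, ← mul_pow]
      simp
  · intro σ hσ hσ'
    rw [Finset.mem_filter, not_and] at hσ'
    rcases eq_or_eq_of_mem_unshuffles (Nat.le_add_right _ _) hσ hM' (σ.apply_symm_apply M) 
      with ht | ⟨ht, htM⟩
    · refine absurd ?_ (hσ' hσ)
      have : R = σ.symm M := Fin.ext (by omega)
      rw [this, σ.apply_symm_apply]
    · have hσM : σ M = M := (σ.symm_apply_eq.1 htM).symm
      rw [insertLast_eq_zero hα h hM' (htM ▸ ht |>.trans' (by omega)), smul_zero]
      simpa [hσM] using hz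

theorem VanishesOnLast.circProd {p : ℕ} {α : Cochain g p} (hα : IsPairAlternating K α)
    (h : VanishesOnLast α) (h' : VanishesOnLast β) : VanishesOnLast (circProd p q α β) := by
  intro xs ys z m hm hz
  rw [circProd_eq]
  rcases p with _ | r
  · rw [Fin.sum_univ_zero, zero_add, Finset.sum_eq_zero, smul_zero]
    intro σ hσ
    rcases eq_or_eq_of_mem_unshuffles (Nat.le_add_right _ _) hσ hm (σ.apply_symm_apply m) 
      with ht | ⟨ht, htM⟩
    · omega
    · have hσM : σ m = m := (σ.symm_apply_eq.1 htM).symm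
      rw [insertLast_eq_zero hα h' hm (Nat.zero_le _), smul_zero]
      simpa [hσM] using hz
  have hfix : ∀ k ≤ r, ∀ σ ∈ unshuffles (r + 1 + q) k (k + q), σ m = m := fun k hk σ hσ =>
    (mem_unshuffles.1 hσ).1 m (by omega)
  rw [Fin.sum_univ_castSucc, Finset.sum_eq_zero, zero_add,
    sum_insertLast_eq (R := ⟨r, by omega⟩) (M := m) hα h' rfl (by omega) hz, smul_smul, ← pow_add,
    show (r + 1) * q + q = r * q + 2 * q by ring, pow_add, pow_mul (-1 : ℤ) 2 q,
    neg_one_sq, one_pow, mul_one, Fin.val_last, ← smul_add, ← Finset.sum_add_distrib,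
    Finset.sum_eq_zero, smul_zero]
  · intro τ hτ
    rw [← smul_add, insert_last_add_insertLast_eq_zero (M := m) hα h rfl (by omega), smul_zero]
    simpa [hfix r le_rfl τ hτ] using hz
  · intro k _
    rw [Finset.sum_eq_zero, smul_zero]
    intro σ hσ
    have hz' : (xs ∘ σ) m = z ∨ (ys ∘ σ) m = z := by
      simpa [hfix k k.isLt.le σ hσ] using hz
    have hk : (k.castSucc : ℕ) + 1 < r + 1 := by simp
    rw [insertFst_eq_zero h hk hm hz', insertSnd_eq_zero h hk hm hz', add_zero, smul_zero]

end

section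

variable {K : Type*} [Field K] {g : Type*} [AddCommGroup g] [Module K g] {p q : ℕ}

theorem IsCochain.circProd {α : Cochain g p} {β : Cochain g q} (hα : IsCochain K p α)
    (hβ : IsCochain K q β) : IsCochain K (p + q) (circProd p q α β) := by
  rw [isCochain_iff] at *
  exact ⟨hα.1.circProd hβ.1, hα.2.circProd hα.1 hβ.2⟩

theorem IsCochain.cast {m n : ℕ} (e : m = n) {f : Cochain g n} (hf : IsCochain K n f) :
    IsCochain K m (fun xs ys z => f (fun i => xs (Fin.cast e.symm i))
      (fun i => ys (Fin.cast e.symm i)) z) := by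
  subst e
  exact hf

theorem IsCochain.sub_zsmul {f f' : Cochain g p} (hf : IsCochain K p f) (n : ℤ)
    (hf' : IsCochain K p f') :
    IsCochain K p (fun xs ys z => f xs ys z - n • f' xs ys z) := by
  rw [isCochain_iff] at *
  refine ⟨?_, fun xs ys z i hi hz => by
    simp only
    rw [hf.2 xs ys z i hi hz, hf'.2 xs ys z i hi hz, smul_zero, sub_zero]⟩
  simpa only [neg_smul, ← sub_eq_add_neg] using hf.1.add (hf'.1.zsmul (-n))

theorem IsCochain.nrBracket {α : Cochain g p} {β : Cochain g q} (hα : IsCochain K p α)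
    (hβ : IsCochain K q β) : IsCochain K (p + q) (nrBracket p q α β) :=
  (hα.circProd hβ).sub_zsmul _ ((hβ.circProd hα).cast (Nat.add_comm p q))

theorem circProd_mem (S : AddSubgroup g) {α : Cochain g p} {β : Cochain g q}
    {xs ys : Fin (p + q) → g} {z : g}
    (hfst : ∀ k (σ : Equiv.Perm (Fin (p + q))), insertFst α β k (xs ∘ σ) (ys ∘ σ) z ∈ S)
    (hsnd : ∀ k (σ : Equiv.Perm (Fin (p + q))), insertSnd α β k (xs ∘ σ) (ys ∘ σ) z ∈ S)
    (hlast : ∀ σ : Equiv.Perm (Fin (p + q)), insertLast α β (xs ∘ σ) (ys ∘ σ) z ∈ S) :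
    circProd p q α β xs ys z ∈ S := by
  rw [circProd_eq]
  exact S.add_mem
    (S.sum_mem fun k _ => S.zsmul_mem (S.sum_mem fun σ _ =>
      S.zsmul_mem (S.add_mem (hfst k σ) (hsnd k σ)) _) _)
    (S.zsmul_mem (S.sum_mem fun σ _ => S.zsmul_mem (hlast σ) _) _)

end

section

variable {K : Type*} [Field K] {g h : Type*} [AddCommGroup g] [Module K g] [AddCommGroup h]
  [Module K h] {p q : ℕ}

theorem circProd_eq_zero_of_maps_to {α : Cochain (g × h) p} {β : Cochain (g × h) q}
    (hα : ∀ xs ys z, (∀ i, (xs i).1 = 0) → (∀ i, (ys i).1 = 0) → z.1 = 0 → α xs ys z = 0)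
    (hβ : ∀ xs ys z, (∀ i, (xs i).1 = 0) → (∀ i, (ys i).1 = 0) → z.1 = 0 → (β xs ys z).1 = 0)
    {xs ys : Fin (p + q) → g × h} {z : g × h} (hxs : ∀ i, (xs i).1 = 0)
    (hys : ∀ i, (ys i).1 = 0) (hz : z.1 = 0) : circProd p q α β xs ys z = 0 := by
  refine circProd_mem ⊥ (fun k σ => ?_) (fun k σ => ?_) fun σ => ?_
  · exact hα _ _ _ (insertArg_fst_eq_zero (hβ _ _ _ (fun _ => hxs _) (fun _ => hys _) (hxs _))
      fun _ => hxs _) (insertArg_fst_eq_zero (hys _) fun _ => hys _) hz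
  · exact hα _ _ _ (insertArg_fst_eq_zero (hxs _) fun _ => hxs _) (insertArg_fst_eq_zero
      (hβ _ _ _ (fun _ => hxs _) (fun _ => hys _) (hys _)) fun _ => hys _) hz
  · exact hα _ _ _ (fun _ => hxs _) (fun _ => hys _)
      (hβ _ _ _ (fun _ => hxs _) (fun _ => hys _) hz)

theorem circProd_fst_eq_zero {α : Cochain (g × h) p} (hα : ∀ xs ys z, (α xs ys z).1 = 0)
    (β : Cochain (g × h) q) (xs ys : Fin (p + q) → g × h) (z : g × h) :
    (circProd p q α β xs ys z).1 = 0 :=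
  circProd_mem (AddMonoidHom.fst g h).ker (fun _ _ => hα _ _ _) (fun _ _ => hα _ _ _)
    fun _ => hα _ _ _

theorem IsRelCochain.nrBracket_of {α : Cochain (g × h) p} {β : Cochain (g × h) q}
    (h1 : ∀ xs ys z, (circProd p q α β xs ys z).1 = 0)
    (h2 : ∀ xs ys z, (∀ i, (xs i).1 = 0) → (∀ i, (ys i).1 = 0) → z.1 = 0 →
      circProd p q α β xs ys z = 0)
    (h3 : ∀ xs ys z, (circProd q p β α xs ys z).1 = 0)
    (h4 : ∀ xs ys z, (∀ i, (xs i).1 = 0) → (∀ i, (ys i).1 = 0) → z.1 = 0 →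
      circProd q p β α xs ys z = 0) :
    IsRelCochain (p + q) (nrBracket p q α β) := by
  refine ⟨fun xs ys z => ?_, fun xs ys z hxs hys hz => ?_⟩
  · rw [nrBracket, Prod.fst_sub, Prod.smul_fst, h1, h3, smul_zero, sub_zero]
  · rw [nrBracket, h2 xs ys z hxs hys hz, h4 _ _ z (fun _ => hxs _) (fun _ => hys _) hz,
      smul_zero, sub_zero]

theorem IsRelCochain.nrBracket {α : Cochain (g × h) p} {β : Cochain (g × h) q}
    (hα : IsRelCochain p α) (hβ : IsRelCochain q β) :
    IsRelCochain (p + q) (nrBracket p q α β) :=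
  nrBracket_of (circProd_fst_eq_zero hα.1 β)
    (fun _ _ _ => circProd_eq_zero_of_maps_to hα.2 fun _ _ _ _ _ _ => hβ.1 _ _ _)
    (circProd_fst_eq_zero hβ.1 α)
    (fun _ _ _ => circProd_eq_zero_of_maps_to hβ.2 fun _ _ _ _ _ _ => hα.1 _ _ _)

theorem isCochain_sumC1 (bg : g →ₗ[K] g →ₗ[K] g →ₗ[K] g) (bh : h →ₗ[K] h →ₗ[K] h →ₗ[K] h)
    (hgalt : ∀ x y z : g, x = y ∨ y = z ∨ x = z → bg x y z = 0)
    (hhalt : ∀ u v w : h, u = v ∨ v = w ∨ u = w → bh u v w = 0) :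
    IsCochain K 1 (sumC1 bg bh) := by
  refine ⟨fun xs ys z i u v => ?_, fun xs ys z i a u => ?_, fun xs ys z i u v => ?_,
    fun xs ys z i a u => ?_, fun xs ys u v => by simp [sumC1], fun xs ys a u => by simp [sumC1],
    fun xs ys z i hi => ?_, fun xs ys z i _ hi => ?_⟩ <;> obtain rfl := Subsingleton.elim 0 i
  · simp [sumC1]
  · simp [sumC1]
  · simp [sumC1]
  · simp [sumC1]
  · rw [sumC1, hi, hgalt _ _ _ (Or.inl rfl), hhalt _ _ _ (Or.inl rfl), Prod.mk_zero_zero]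
  · rcases hi with rfl | rfl
    · rw [sumC1, hgalt _ _ _ (Or.inr (Or.inr rfl)), hhalt _ _ _ (Or.inr (Or.inr rfl)),
        Prod.mk_zero_zero]
    · rw [sumC1, hgalt _ _ _ (Or.inr (Or.inl rfl)), hhalt _ _ _ (Or.inr (Or.inl rfl)),
        Prod.mk_zero_zero]

/-- `h` is an ideal of `g ⊕ h`: inserting a cochain valued in `h` into the bracket gives a cochain
valued in `h`. -/
theorem circProd_sumC1_fst_eq_zero (bg : g →ₗ[K] g →ₗ[K] g →ₗ[K] g)
    (bh : h →ₗ[K] h →ₗ[K] h →ₗ[K] h) {α : Cochain (g × h) p} (hα : ∀ xs ys z, (α xs ys z).1 = 0)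
    (xs ys : Fin (1 + p) → g × h) (z : g × h) :
    (circProd 1 p (sumC1 bg bh) α xs ys z).1 = 0 := by
  refine circProd_mem (AddMonoidHom.fst g h).ker (fun k σ => ?_) (fun k σ => ?_) fun σ => ?_ <;>
    rw [AddMonoidHom.mem_ker, AddMonoidHom.coe_fst]
  · simp [insertFst, sumC1, insertArg_one_zero, hα]
  · simp [insertSnd, sumC1, insertArg_one_zero, hα]
  · simp [insertLast, sumC1, hα]

/-- Inserting a relative cochain into the bracket gives zero on elements of `h`. -/
theorem circProd_sumC1_eq_zero (bg : g →ₗ[K] g →ₗ[K] g →ₗ[K] g)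
    (bh : h →ₗ[K] h →ₗ[K] h →ₗ[K] h) {α : Cochain (g × h) p} (hα : IsRelCochain p α)
    {xs ys : Fin (1 + p) → g × h} {z : g × h} (hxs : ∀ i, (xs i).1 = 0)
    (hys : ∀ i, (ys i).1 = 0) (hz : z.1 = 0) :
    circProd 1 p (sumC1 bg bh) α xs ys z = 0 := by
  have hzero : ∀ (k : ℕ) (hk : k ≤ 1) (σ : Equiv.Perm (Fin (1 + p))) (w : g × h), w.1 = 0 →
      α (blockArg p k hk (xs ∘ σ)) (blockArg p k hk (ys ∘ σ)) w = 0 := fun k hk σ w hw =>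
    hα.2 _ _ _ (fun _ => hxs _) (fun _ => hys _) hw
  refine circProd_mem ⊥ (fun k σ => ?_) (fun k σ => ?_) fun σ => ?_ <;>
    rw [AddSubgroup.mem_bot]
  · rw [insertFst, hzero k k.isLt.le σ (pivotArg p k (xs ∘ σ)) (hxs _)]
    simp [sumC1, insertArg_one_zero]
  · rw [insertSnd, hzero k k.isLt.le σ (pivotArg p k (ys ∘ σ)) (hys _)]
    simp [sumC1, insertArg_one_zero]
  · rw [insertLast, hzero _ _ _ _ hz]
    simp [sumC1]

theorem IsRelCochain.nrBracket_sumC1 (bg : g →ₗ[K] g →ₗ[K] g →ₗ[K] g)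
    (bh : h →ₗ[K] h →ₗ[K] h →ₗ[K] h) {α : Cochain (g × h) p} (hα : IsRelCochain p α) :
    IsRelCochain (1 + p) (_root_.nrBracket 1 p (sumC1 bg bh) α) :=
  nrBracket_of (circProd_sumC1_fst_eq_zero bg bh hα.1)
    (fun _ _ _ => circProd_sumC1_eq_zero bg bh hα) (circProd_fst_eq_zero hα.1 _)
    (fun _ _ _ => circProd_eq_zero_of_maps_to hα.2 fun _ _ _ hxs _ _ => by simp [sumC1, hxs])

theorem circProd_toC0 (ξ η : g →ₗ[K] h) (xs ys : Fin (0 + 0) → g × h) (z : g × h) :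
    circProd 0 0 (toC0 ξ) (toC0 η) xs ys z = 0 :=
  circProd_mem ⊥ (fun k => k.elim0) (fun k => k.elim0) fun σ => by simp [insertLast, toC0]

end

/-- `C_>(g⊕h, h)` is a sub-DGLA of `C(g⊕h, g⊕h)`: it is closed under
`⟦·,·⟧` and under `δ̄ = ⟦μ,·⟧` for the direct-sum structure `μ`, and its degree-0
part `Hom(g,h)` is abelian. -/
theorem relCochains_sub_dgla {K : Type*} [Field K] [CharZero K]
    {g h : Type*} [AddCommGroup g] [Module K g] [AddCommGroup h] [Module K h]
    (bg : g →ₗ[K] g →ₗ[K] g →ₗ[K] g) (bh : h →ₗ[K] h →ₗ[K] h →ₗ[K] h)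
    (hgalt : ∀ x y z : g, x = y ∨ y = z ∨ x = z → bg x y z = 0)
    (hgfi : ∀ x1 x2 x3 x4 x5 : g,
      bg x1 x2 (bg x3 x4 x5)
        = bg (bg x1 x2 x3) x4 x5 + bg x3 (bg x1 x2 x4) x5 + bg x3 x4 (bg x1 x2 x5))
    (hhalt : ∀ u v w : h, u = v ∨ v = w ∨ u = w → bh u v w = 0)
    (hhfi : ∀ v1 v2 v3 v4 v5 : h,
      bh v1 v2 (bh v3 v4 v5)
        = bh (bh v1 v2 v3) v4 v5 + bh v3 (bh v1 v2 v4) v5 + bh v3 v4 (bh v1 v2 v5))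
    (p q : ℕ) (α : Cochain (g × h) p) (β : Cochain (g × h) q)
    (hα : IsCochain K p α) (hα' : IsRelCochain p α)
    (hβ : IsCochain K q β) (hβ' : IsRelCochain q β)
    (ξ η : g →ₗ[K] h) :
    -- (a) closure under the bracket:
    (IsCochain K (p + q) (nrBracket p q α β) ∧ IsRelCochain (p + q) (nrBracket p q α β)) ∧
    -- (b) closure under the differential:
    (IsCochain K (1 + p) (nrBracket 1 p (sumC1 bg bh) α) ∧
      IsRelCochain (1 + p) (nrBracket 1 p (sumC1 bg bh) α)) ∧
    -- (c) the degree-0 part Hom(g,h) is abelian: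
    (∀ (xs ys : Fin (0 + 0) → g × h) (z : g × h),
      nrBracket 0 0 (toC0 ξ) (toC0 η) xs ys z = 0) := by
  refine ⟨⟨hα.nrBracket hβ, hα'.nrBracket hβ'⟩,
    ⟨(isCochain_sumC1 bg bh hgalt hhalt).nrBracket hα, hα'.nrBracket_sumC1 bg bh⟩,
    fun xs ys z => ?_⟩
  rw [nrBracket, circProd_toC0, circProd_toC0, smul_zero, sub_zero]
end

section
/- Let g, h be 3-Lie algebras over a field K of characteristic 0, (ρ,ν,ω) extension data with associated cochain c ∈ C¹_>(g⊕h,h), and ξ: g → h a linear map viewed as a degree-0 cochain on g⊕h (extended by 0 on h), with ⟦ξ,γ⟧(e1∧e2,e3) = ξ(γ(e1∧e2,e3)) − γ(ξ(e1)∧e2,e3) − γ(e1∧ξ(e2),e3) − γ(e1∧e2,ξ(e3)) for degree-1 cochains γ. Then for all e_i = x_i + v_i ∈ g⊕h: (a) ⟦ξ,c⟧(e1∧e2,e3) = −ρ(x2,x3)ξ(x1) − ν(x2)(v3,ξ(x1)) − ν(x3)(ξ(x1),v2) − ρ(x3,x1)ξ(x2) − ν(x1)(ξ(x2),v3) − ν(x3)(v1,ξ(x2))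 − ρ(x1,x2)ξ(x3) − ν(x1)(v2,ξ(x3)) − ν(x2)(ξ(x3),v1); (b) ⟦ξ,⟦ξ,c⟧⟧(e1∧e2,e3) = 2ν(x1)(ξ(x2),ξ(x3)) + 2ν(x2)(ξ(x3),ξ(x1)) + 2ν(x3)(ξ(x1),ξ(x2)); (c) ⟦ξ,⟦ξ,⟦ξ,c⟧⟧⟧ = 0. -/
section

variable {K : Type*} [Field K]
variable {g h : Type*} [AddCommGroup g] [Module K g] [AddCommGroup h] [Module K h]

/-- The degree-1 cochain `c ∈ C¹_>(g⊕h, h)` associated to the extension data,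
with values embedded in `g ⊕ h`. -/
def extCochain (ρ : g →ₗ[K] g →ₗ[K] Module.End K h)
    (ν : g →ₗ[K] h →ₗ[K] h →ₗ[K] h)
    (ω : g →ₗ[K] g →ₗ[K] g →ₗ[K] h) :
    g × h → g × h → g × h → g × h :=
  fun a b c =>
    ((0 : g),
      ω a.1 b.1 c.1 + ρ a.1 b.1 c.2 + ρ b.1 c.1 a.2 + ρ c.1 a.1 b.2
        + ν a.1 b.2 c.2 + ν b.1 c.2 a.2 + ν c.1 a.2 b.2)

/-- A linear map `ξ : g → h` viewed as a degree-0 cochain on `g ⊕ h`, extended by `0` on `h`. -/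
def deg0 (ξ : g →ₗ[K] h) : g × h → g × h := fun e => ((0 : g), ξ e.1)

/-- The bracket `⟦ξ,γ⟧` of a degree-0 cochain `ξ` with a degree-1 cochain `γ` on `g ⊕ h`. -/
def bracket01 (ξ : g × h → g × h) (γ : g × h → g × h → g × h → g × h) :
    g × h → g × h → g × h → g × h :=
  fun e1 e2 e3 => ξ (γ e1 e2 e3) - γ (ξ e1) e2 e3 - γ e1 (ξ e2) e3 - γ e1 e2 (ξ e3)

end

/-- explicit formulas for `⟦ξ,c⟧`, `⟦ξ,⟦ξ,c⟧⟧` and `⟦ξ,⟦ξ,⟦ξ,c⟧⟧⟧ = 0`. -/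
theorem bracket01_extCochain_formulas {K : Type*} [Field K] [CharZero K]
    {g h : Type*} [AddCommGroup g] [Module K g] [AddCommGroup h] [Module K h]
    (bg : g →ₗ[K] g →ₗ[K] g →ₗ[K] g) (bh : h →ₗ[K] h →ₗ[K] h →ₗ[K] h)
    (hgalt : ∀ x y z : g, x = y ∨ y = z ∨ x = z → bg x y z = 0)
    (hgfi : ∀ x1 x2 x3 x4 x5 : g,
      bg x1 x2 (bg x3 x4 x5)
        = bg (bg x1 x2 x3) x4 x5 + bg x3 (bg x1 x2 x4) x5 + bg x3 x4 (bg x1 x2 x5))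
    (hhalt : ∀ u v w : h, u = v ∨ v = w ∨ u = w → bh u v w = 0)
    (hhfi : ∀ v1 v2 v3 v4 v5 : h,
      bh v1 v2 (bh v3 v4 v5)
        = bh (bh v1 v2 v3) v4 v5 + bh v3 (bh v1 v2 v4) v5 + bh v3 v4 (bh v1 v2 v5))
    (ρ : g →ₗ[K] g →ₗ[K] Module.End K h) (hρ : ∀ x y : g, ρ x y = - ρ y x)
    (ν : g →ₗ[K] h →ₗ[K] h →ₗ[K] h) (hν : ∀ (x : g) (u v : h), ν x u v = - ν x v u)
    (ω : g →ₗ[K] g →ₗ[K] g →ₗ[K] h)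
    (hω : ∀ x y z : g, x = y ∨ y = z ∨ x = z → ω x y z = 0)
    (ξ : g →ₗ[K] h) :
    (∀ (x1 x2 x3 : g) (v1 v2 v3 : h),
      bracket01 (deg0 ξ) (extCochain ρ ν ω) (x1, v1) (x2, v2) (x3, v3)
        = ((0 : g),
            - ρ x2 x3 (ξ x1) - ν x2 v3 (ξ x1) - ν x3 (ξ x1) v2
            - ρ x3 x1 (ξ x2) - ν x1 (ξ x2) v3 - ν x3 v1 (ξ x2)
            - ρ x1 x2 (ξ x3) - ν x1 v2 (ξ x3) - ν x2 (ξ x3) v1)) ∧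
    (∀ (x1 x2 x3 : g) (v1 v2 v3 : h),
      bracket01 (deg0 ξ) (bracket01 (deg0 ξ) (extCochain ρ ν ω)) (x1, v1) (x2, v2) (x3, v3)
        = ((0 : g),
            (2 : K) • (ν x1 (ξ x2) (ξ x3) + ν x2 (ξ x3) (ξ x1) + ν x3 (ξ x1) (ξ x2)))) ∧
    (∀ e1 e2 e3 : g × h,
      bracket01 (deg0 ξ)
        (bracket01 (deg0 ξ) (bracket01 (deg0 ξ) (extCochain ρ ν ω))) e1 e2 e3 = 0) := by
  refine ⟨fun x1 x2 x3 v1 v2 v3 => ?_, fun x1 x2 x3 v1 v2 v3 => ?_, fun e1 e2 e3 => ?_⟩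
  · ext
    · simp [bracket01, deg0, extCochain]
    · simp [bracket01, deg0, extCochain]
      abel
  · ext
    · simp [bracket01, deg0, extCochain]
    · simp [bracket01, deg0, extCochain]
      module
  · ext <;> simp [bracket01, deg0, extCochain]
end

section
/- Let g, h be 3-Lie algebras over a field K of characteristic 0 and ξ: g → h a linear map, viewed as a degree-0 cochain on g⊕h (extended by 0 on h). Define δ̄ξ(e1∧e2,e3) = [ξ(e1),e2,e3] + [e1,ξ(e2),e3] + [e1,e2,ξ(e3)] − ξ([e1,e2,e3]) with respect to the direct-sum bracket on g⊕h, and ⟦ξ,γ⟧(e1∧e2,e3) = ξ(γ(e1∧e2,e3)) − γ(ξ(e1)∧e2,e3) − γ(e1∧ξ(e2),e3) − γ(e1∧e2,ξ(e3)) for degree-1 cochains γ. Then for all e_i = x_i + v_i ∈ g⊕h: (a) δ̄ξ(e1∧e2,e3) = [ξ(x1),v2,v3]_h + [v1,ξ(x2),v3]_h + [v1,v2,ξ(x3)]_h − ξ([x1,x2,x3]_g); (b) ⟦ξ,δ̄ξ⟧(e1∧e2,e3) = −2[ξ(x1),ξ(x2),v3]_h − 2[v1,ξ(x2),ξ(x3)]_h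 − 2[ξ(x1),v2,ξ(x3)]_h; (c) ⟦ξ,⟦ξ,δ̄ξ⟧⟧(e1∧e2,e3) = 6[ξ(x1),ξ(x2),ξ(x3)]_h; (d) ⟦ξ,⟦ξ,⟦ξ,δ̄ξ⟧⟧⟧ = 0. -/
section

variable {K : Type*} [Field K]
variable {g h : Type*} [AddCommGroup g] [Module K g] [AddCommGroup h] [Module K h]

/-- The direct-sum 3-Lie bracket on `g ⊕ h`. -/
def sumBracket (bg : g →ₗ[K] g →ₗ[K] g →ₗ[K] g) (bh : h →ₗ[K] h →ₗ[K] h →ₗ[K] h) :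
    g × h → g × h → g × h → g × h :=
  fun a b c => (bg a.1 b.1 c.1, bh a.2 b.2 c.2)

/-- The differential `δ̄ξ` of a degree-0 cochain `ξ`, with respect to the direct-sum
bracket on `g ⊕ h`. -/
def delta0 (bg : g →ₗ[K] g →ₗ[K] g →ₗ[K] g) (bh : h →ₗ[K] h →ₗ[K] h →ₗ[K] h)
    (ξ : g →ₗ[K] h) : g × h → g × h → g × h → g × h :=
  fun e1 e2 e3 =>
    sumBracket bg bh (deg0 ξ e1) e2 e3 + sumBracket bg bh e1 (deg0 ξ e2) e3
      + sumBracket bg bh e1 e2 (deg0 ξ e3) - deg0 ξ (sumBracket bg bh e1 e2 e3)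

end

/-- explicit formulas for `δ̄ξ`, `⟦ξ,δ̄ξ⟧`, `⟦ξ,⟦ξ,δ̄ξ⟧⟧` and
`⟦ξ,⟦ξ,⟦ξ,δ̄ξ⟧⟧⟧ = 0`. -/
theorem delta0_bracket_formulas {K : Type*} [Field K] [CharZero K]
    {g h : Type*} [AddCommGroup g] [Module K g] [AddCommGroup h] [Module K h]
    (bg : g →ₗ[K] g →ₗ[K] g →ₗ[K] g) (bh : h →ₗ[K] h →ₗ[K] h →ₗ[K] h)
    (hgalt : ∀ x y z : g, x = y ∨ y = z ∨ x = z → bg x y z = 0)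
    (hgfi : ∀ x1 x2 x3 x4 x5 : g,
      bg x1 x2 (bg x3 x4 x5)
        = bg (bg x1 x2 x3) x4 x5 + bg x3 (bg x1 x2 x4) x5 + bg x3 x4 (bg x1 x2 x5))
    (hhalt : ∀ u v w : h, u = v ∨ v = w ∨ u = w → bh u v w = 0)
    (hhfi : ∀ v1 v2 v3 v4 v5 : h,
      bh v1 v2 (bh v3 v4 v5)
        = bh (bh v1 v2 v3) v4 v5 + bh v3 (bh v1 v2 v4) v5 + bh v3 v4 (bh v1 v2 v5))
    (ξ : g →ₗ[K] h) :
    (∀ (x1 x2 x3 : g) (v1 v2 v3 : h),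
      delta0 bg bh ξ (x1, v1) (x2, v2) (x3, v3)
        = ((0 : g),
            bh (ξ x1) v2 v3 + bh v1 (ξ x2) v3 + bh v1 v2 (ξ x3) - ξ (bg x1 x2 x3))) ∧
    (∀ (x1 x2 x3 : g) (v1 v2 v3 : h),
      bracket01 (deg0 ξ) (delta0 bg bh ξ) (x1, v1) (x2, v2) (x3, v3)
        = ((0 : g),
            - (2 : K) • bh (ξ x1) (ξ x2) v3 - (2 : K) • bh v1 (ξ x2) (ξ x3)
              - (2 : K) • bh (ξ x1) v2 (ξ x3))) ∧
    (∀ (x1 x2 x3 : g) (v1 v2 v3 : h),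
      bracket01 (deg0 ξ) (bracket01 (deg0 ξ) (delta0 bg bh ξ)) (x1, v1) (x2, v2) (x3, v3)
        = ((0 : g), (6 : K) • bh (ξ x1) (ξ x2) (ξ x3))) ∧
    (∀ e1 e2 e3 : g × h,
      bracket01 (deg0 ξ)
        (bracket01 (deg0 ξ) (bracket01 (deg0 ξ) (delta0 bg bh ξ))) e1 e2 e3 = 0) := by
  have h_delta : ∀ (x1 x2 x3 : g) (v1 v2 v3 : h),
      delta0 bg bh ξ (x1, v1) (x2, v2) (x3, v3)
        = ((0 : g),
            bh (ξ x1) v2 v3 + bh v1 (ξ x2) v3 + bh v1 v2 (ξ x3) - ξ (bg x1 x2 x3)) := by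
    intro x1 x2 x3 v1 v2 v3
    simp [delta0, sumBracket, deg0]
  have h_once : ∀ (x1 x2 x3 : g) (v1 v2 v3 : h),
      bracket01 (deg0 ξ) (delta0 bg bh ξ) (x1, v1) (x2, v2) (x3, v3)
        = ((0 : g),
            - (2 : K) • bh (ξ x1) (ξ x2) v3 - (2 : K) • bh v1 (ξ x2) (ξ x3)
              - (2 : K) • bh (ξ x1) v2 (ξ x3)) := by
    intro x1 x2 x3 v1 v2 v3
    rw [bracket01]
    simp only [deg0, h_delta]
    ext
    · simp
    · simp
      module
  have h_twice : ∀ (x1 x2 x3 : g) (v1 v2 v3 : h),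
      bracket01 (deg0 ξ) (bracket01 (deg0 ξ) (delta0 bg bh ξ)) (x1, v1) (x2, v2) (x3, v3)
        = ((0 : g), (6 : K) • bh (ξ x1) (ξ x2) (ξ x3)) := by
    intro x1 x2 x3 v1 v2 v3
    rw [bracket01]
    simp only [deg0] at h_once ⊢
    simp only [h_once]
    ext
    · simp
    · simp
      module
  refine ⟨h_delta, h_once, h_twice, ?_⟩
  rintro ⟨x1, v1⟩ ⟨x2, v2⟩ ⟨x3, v3⟩
  rw [bracket01]
  simp only [deg0] at h_twice ⊢
  simp [h_twice]
end
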